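/- arXiv:math/0212138 — 2 statements merged into one kernel-verified Lean document; each statement's English description precedes it below -/
import Mathlib

section
/- Let n ≥ 2, let h be a non-zero integer, and consider the action of Bₙ on the free group Fₙ via the Wada representation ρ_h^{(1)}. Then the subgroup Fₙ^{Bₙ} = {u ∈ Fₙ : ρ_h^{(1)}(β)(u) = u for all β ∈ Bₙ} is the cyclic subgroup of Fₙ generated by the element xₙ^{h} x_{n−1}^{h} ⋯ x₂^{h} x₁^{h}. -/
def braidRels (m : ℕ) : Set (FreeGroup (Fin m)) :=
  { r | (∃ i j : Fin m, (i : ℕ) + 1 = (j : ℕ) ∧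
          r = FreeGroup.of i * FreeGroup.of j * FreeGroup.of i *
              (FreeGroup.of j * FreeGroup.of i * FreeGroup.of j)⁻¹) ∨
        (∃ i j : Fin m, (i : ℕ) + 2 ≤ (j : ℕ) ∧
          r = FreeGroup.of i * FreeGroup.of j * (FreeGroup.of j * FreeGroup.of i)⁻¹) }

abbrev BraidGroup (m : ℕ) : Type := PresentedGroup (braidRels m)

def braidGen {m : ℕ} (i : Fin m) : BraidGroup m := PresentedGroup.of i

def idx0 {n : ℕ} (k : Fin (n - 1)) : Fin n := ⟨k.1, by have := k.2; omega⟩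
def idx1 {n : ℕ} (k : Fin (n - 1)) : Fin n := ⟨k.1 + 1, by have := k.2; omega⟩


/-- Wada's representation of type (1) with parameter `h`:
`σ_k ↦ (x_k ↦ x_k^{-h} x_{k+1} x_k^h, x_{k+1} ↦ x_k)`. -/
def IsWada1 {n : ℕ} (h : ℤ) (ρ : BraidGroup (n - 1) →* MulAut (FreeGroup (Fin n))) : Prop :=
  ∀ k : Fin (n - 1),
    ρ (braidGen k) (FreeGroup.of (idx0 k)) =
      (FreeGroup.of (idx0 k)) ^ (-h) * FreeGroup.of (idx1 k) * (FreeGroup.of (idx0 k)) ^ h ∧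
    ρ (braidGen k) (FreeGroup.of (idx1 k)) = FreeGroup.of (idx0 k) ∧
    ∀ j : Fin n, j ≠ idx0 k → j ≠ idx1 k → ρ (braidGen k) (FreeGroup.of j) = FreeGroup.of j

/-- Wada's representation of type (2):
`σ_k ↦ (x_k ↦ x_k x_{k+1}⁻¹ x_k, x_{k+1} ↦ x_k)`. -/
def IsWada2 {n : ℕ} (ρ : BraidGroup (n - 1) →* MulAut (FreeGroup (Fin n))) : Prop :=
  ∀ k : Fin (n - 1),
    ρ (braidGen k) (FreeGroup.of (idx0 k)) =
      FreeGroup.of (idx0 k) * (FreeGroup.of (idx1 k))⁻¹ * FreeGroup.of (idx0 k) ∧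
    ρ (braidGen k) (FreeGroup.of (idx1 k)) = FreeGroup.of (idx0 k) ∧
    ∀ j : Fin n, j ≠ idx0 k → j ≠ idx1 k → ρ (braidGen k) (FreeGroup.of j) = FreeGroup.of j

/-- Wada's representation of type (3):
`σ_k ↦ (x_k ↦ x_k² x_{k+1}, x_{k+1} ↦ x_{k+1}⁻¹ x_k⁻¹ x_{k+1})`. -/
def IsWada3 {n : ℕ} (ρ : BraidGroup (n - 1) →* MulAut (FreeGroup (Fin n))) : Prop :=
  ∀ k : Fin (n - 1),
    ρ (braidGen k) (FreeGroup.of (idx0 k)) =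
      FreeGroup.of (idx0 k) ^ 2 * FreeGroup.of (idx1 k) ∧
    ρ (braidGen k) (FreeGroup.of (idx1 k)) =
      (FreeGroup.of (idx1 k))⁻¹ * (FreeGroup.of (idx0 k))⁻¹ * FreeGroup.of (idx1 k) ∧
    ∀ j : Fin n, j ≠ idx0 k → j ≠ idx1 k → ρ (braidGen k) (FreeGroup.of j) = FreeGroup.of j

/-- Two representations `ρ, ρ' : B → Aut G` are equivalent if there are automorphisms
`φ : G → G` and `μ : B → B` with `ρ'(μ(β)) = φ⁻¹ ∘ ρ(β) ∘ φ` for all `β`. -/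
def EquivReps {B G : Type*} [Group B] [Group G] (ρ ρ' : B →* MulAut G) : Prop :=
  ∃ (φ : G ≃* G) (μ : B ≃* B), ∀ (β : B) (g : G), ρ' (μ β) g = φ.symm (ρ β (φ g))

/-- If two families agree away from the consecutive indices `k`, `k + 1`, and have the same product
over these two indices, then their products in decreasing order agree. -/
theorem prod_reverse_ofFn_congr_adjacent {G : Type*} [Group G] :
    ∀ (n k : ℕ) (hk : k + 1 < n) (f g : Fin n → G),
      (∀ j : Fin n, (j : ℕ) ≠ k → (j : ℕ) ≠ k + 1 → f j = g j) →
      f ⟨k + 1, hk⟩ * f ⟨k, by omega⟩ = g ⟨k + 1, hk⟩ * g ⟨k, by omega⟩ →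
      (List.ofFn f).reverse.prod = (List.ofFn g).reverse.prod
  | 0, _, hk, _, _, _, _ => absurd hk (by omega)
  | 1, _, hk, _, _, _, _ => absurd hk (by omega)
  | n + 2, 0, _, f, g, hfg, h01 => by
    have htail : (fun i : Fin n => f i.succ.succ) = fun i : Fin n => g i.succ.succ := by
      funext i
      exact hfg _ (by simp) (by simp)
    simp only [List.ofFn_succ, List.reverse_cons, List.prod_append, List.prod_singleton, htail,
      mul_assoc]
    congr 1
  | n + 2, k + 1, hk, f, g, hfg, hkk => by
    rw [List.ofFn_succ (f := f), List.ofFn_succ (f := g), List.reverse_cons, List.reverse_cons, List.prod_append,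
      List.prod_append, List.prod_singleton, List.prod_singleton,
      hfg 0 (by simp) (by simp)]
    congr 1
    refine prod_reverse_ofFn_congr_adjacent (n + 1) k (by omega)
      (fun i => f i.succ) (fun i => g i.succ) (fun j hj hj' => ?_) hkk
    exact hfg _ (by simpa using hj) (by simpa using hj')

/-- An endomorphism shifting the family `X` and acting on `u` as conjugation by `X 0 ^ h` acts
through its `m`-th iterate on `u` as conjugation by `X (m - 1) ^ h * ⋯ * X 0 ^ h`. -/
theorem iterate_shift_apply {G : Type*} [Group G] (τ : G →* G) (X : ℕ → G) (h : ℤ) (u : G)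
    (hX : ∀ i, τ (X i) = X (i + 1)) (hu : τ u = X 0 ^ h * u * (X 0 ^ h)⁻¹) (m : ℕ) :
    τ^[m] u = (List.ofFn fun j : Fin m => X j ^ h).reverse.prod * u *
      ((List.ofFn fun j : Fin m => X j ^ h).reverse.prod)⁻¹ := by
  have hprod : ∀ m : ℕ, τ (List.ofFn fun j : Fin m => X j ^ h).reverse.prod * X 0 ^ h =
      (List.ofFn fun j : Fin (m + 1) => X j ^ h).reverse.prod := by
    intro m
    rw [List.ofFn_succ, List.reverse_cons, List.prod_append, List.prod_singleton, map_list_prod,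
      List.map_reverse, List.map_ofFn]
    simp [Function.comp_def, hX]
  induction m with
  | zero => simp
  | succ m ih =>
    rw [Function.iterate_succ_apply', ih, map_mul, map_mul, map_inv, hu, ← hprod]
    group

/-- Commuting elements of a free group are powers of a common element. -/
theorem Commute.exists_zpow_eq_of_freeGroup {α : Type*} {u w : FreeGroup α} (huw : Commute u w) :
    ∃ (z : FreeGroup α) (a b : ℤ), z ^ a = u ∧ z ^ b = w := by
  let H : Subgroup (FreeGroup α) := Subgroup.closure {u, w}
  have hcomm : ∀ x y : H, x * y = y * x := by
    have : IsMulCommutative H := Subgroup.isMulCommutative_closure (by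
      rintro x (rfl | rfl) y (rfl | rfl)
      exacts [rfl, huw, huw.symm, rfl])
    exact fun x y => this.is_comm.comm x y
  let e : FreeGroup (IsFreeGroup.Generators H) ≃* H := IsFreeGroup.mulEquiv H
  have hsub : Subsingleton (IsFreeGroup.Generators H) := by
    refine ⟨fun x y => ?_⟩
    by_contra hxy
    classical
    have hxy' : FreeGroup.of x * FreeGroup.of y = FreeGroup.of y * FreeGroup.of x :=
      e.injective (by rw [map_mul, map_mul, hcomm])
    have := congrArg (FreeGroup.lift fun t => if t = x then Equiv.swap (0 : Fin 3) 1
      else Equiv.swap (1 : Fin 3) 2) hxy'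
    simp only [map_mul, FreeGroup.lift_apply_of, if_true, if_neg (Ne.symm hxy)] at this
    revert this
    decide
  obtain ⟨z, hz⟩ : ∃ z : FreeGroup (IsFreeGroup.Generators H), ∀ v, ∃ a : ℤ, z ^ a = v := by
    rcases isEmpty_or_nonempty (IsFreeGroup.Generators H) with hE | ⟨⟨x⟩⟩
    · exact ⟨1, fun v => ⟨0, Subsingleton.elim _ _⟩⟩
    · refine ⟨FreeGroup.of x, fun v => ?_⟩
      induction v using FreeGroup.induction_on with
      | C1 => exact ⟨0, zpow_zero _⟩
      | of y => exact ⟨1, by rw [zpow_one, Subsingleton.elim x y]⟩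
      | inv_of y _ => exact ⟨-1, by rw [zpow_neg_one, Subsingleton.elim x y]⟩
      | mul v v' hv hv' =>
        obtain ⟨a, rfl⟩ := hv
        obtain ⟨b, rfl⟩ := hv'
        exact ⟨a + b, zpow_add _ _ _⟩
  have hH : ∀ v ∈ H, ∃ a : ℤ, (e z : FreeGroup α) ^ a = v := by
    intro v hv
    obtain ⟨a, ha⟩ := hz (e.symm ⟨v, hv⟩)
    refine ⟨a, ?_⟩
    have := congrArg e ha
    rw [map_zpow, MulEquiv.apply_symm_apply] at this
    exact congrArg Subtype.val this
  obtain ⟨a, ha⟩ := hH u (Subgroup.subset_closure (by simp))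
  obtain ⟨b, hb⟩ := hH w (Subgroup.subset_closure (by simp))
  exact ⟨e z, a, b, ha, hb⟩

/-- The product `xₙ^h ⋯ x₁^h` is not a proper power in the free group. -/
theorem isUnit_of_zpow_eq_prod_zpow (n : ℕ) (h : ℤ) (hh : h ≠ 0) (z : FreeGroup (Fin (n + 2)))
    (a : ℤ) (hz : z ^ a = (List.ofFn fun j => (FreeGroup.of j) ^ h).reverse.prod) : IsUnit a := by
  have hN : h.natAbs ≠ 0 := Int.natAbs_ne_zero.2 hh
  obtain ⟨ζ, hζ⟩ : ∃ ζ : ℂ, IsPrimitiveRoot ζ h.natAbs :=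
    ⟨_, Complex.isPrimitiveRoot_exp _ hN⟩
  have hζ0 : ζ ≠ 0 := hζ.ne_zero hN
  have hζh : ζ ^ h = 1 := (hζ.zpow_eq_one_iff_dvd h).2 (Int.natAbs_dvd.2 dvd_rfl)
  let c : FreeGroup (Fin (n + 2)) →* Multiplicative ℤ :=
    FreeGroup.lift (Fin.cons (Multiplicative.ofAdd 1) fun _ => 1)
  let φ : FreeGroup (Fin (n + 2)) →* Equiv.Perm ℂ :=
    FreeGroup.lift (Fin.cons (Equiv.mulLeft₀ ζ hζ0) (Fin.cons (Equiv.addRight 1) fun _ => 1))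
  have hcw : c (z ^ a) = Multiplicative.ofAdd h := by
    rw [hz, map_list_prod, List.map_reverse, List.map_ofFn, List.ofFn_succ]
    simp [c, ← ofAdd_zsmul]
  have hφw : ∀ v, φ (z ^ a) v = v + h := by
    intro v
    have h1 : (Equiv.mulLeft₀ ζ hζ0 ^ h) v = v := by
      have : ∀ m : ℤ, ∀ v, (Equiv.mulLeft₀ ζ hζ0 ^ m) v = ζ ^ m * v := by
        intro m
        induction m using Int.induction_on with
        | zero => simp
        | succ i ih =>
          intro v
          rw [zpow_add_one, zpow_add_one₀ hζ0, Equiv.Perm.mul_apply, ih, mul_assoc]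
          rfl
        | pred i ih =>
          intro v
          rw [zpow_sub_one, zpow_sub_one₀ hζ0, Equiv.Perm.mul_apply, ih, mul_assoc]
          rfl
      rw [this, hζh, one_mul]
    have h2 : ((Equiv.addRight 1 : Equiv.Perm ℂ) ^ h) v = v + h := by
      simp
    rw [hz, map_list_prod, List.map_reverse, List.map_ofFn, List.ofFn_succ, List.ofFn_succ]
    simp [φ, h1]
  have haff : ∀ y : FreeGroup (Fin (n + 2)),
      ∃ b : ℂ, ∀ v, φ y v = ζ ^ (Multiplicative.toAdd (c y)) * v + b := by
    have hof : ∀ i : Fin (n + 2), ∃ b : ℂ, ∀ v, φ (FreeGroup.of i) v =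
        ζ ^ (Multiplicative.toAdd (c (FreeGroup.of i))) * v + b := by
      intro i
      refine Fin.cases ⟨0, fun v => by simp [φ, c]⟩ (fun i => ?_) i
      refine Fin.cases ⟨1, fun v => by simp [φ, c]⟩ (fun i => ?_) i
      exact ⟨0, fun v => by simp [φ, c]⟩
    intro y
    induction y using FreeGroup.induction_on with
    | C1 => exact ⟨0, fun v => by simp⟩
    | of i => exact hof i
    | inv_of i _ =>
      obtain ⟨b, hb⟩ := hof i
      refine ⟨-(ζ ^ (-Multiplicative.toAdd (c (FreeGroup.of i))) * b), fun v => ?_⟩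
      rw [map_inv, Equiv.Perm.inv_eq_iff_eq, hb, map_inv, toAdd_inv, zpow_neg]
      field_simp
      ring
    | mul y y' hy hy' =>
      obtain ⟨b, hb⟩ := hy
      obtain ⟨b', hb'⟩ := hy'
      refine ⟨ζ ^ (Multiplicative.toAdd (c y)) * b' + b, fun v => ?_⟩
      rw [map_mul, Equiv.Perm.mul_apply, hb, hb', map_mul, toAdd_mul, zpow_add₀ hζ0]
      ring
  obtain ⟨b, hb⟩ := haff z
  have hac : a * Multiplicative.toAdd (c z) = h := by
    rw [map_zpow] at hcw
    simpa using congrArg Multiplicative.toAdd hcw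
  have hμ : ζ ^ (Multiplicative.toAdd (c z)) = 1 := by
    by_contra hμ
    have hμ' : 1 - ζ ^ (Multiplicative.toAdd (c z)) ≠ 0 := sub_ne_zero.2 (Ne.symm hμ)
    have hfix : φ z (b / (1 - ζ ^ (Multiplicative.toAdd (c z)))) =
        b / (1 - ζ ^ (Multiplicative.toAdd (c z))) := by
      rw [hb]
      field_simp
      ring
    have := hφw (b / (1 - ζ ^ (Multiplicative.toAdd (c z))))
    rw [map_zpow, Equiv.Perm.zpow_apply_eq_self_of_apply_eq_self hfix] at this
    exact hh (by simpa using this)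
  obtain ⟨d, hd⟩ := Int.natAbs_dvd.1 ((hζ.zpow_eq_one_iff_dvd _).1 hμ)
  refine IsUnit.of_mul_eq_one d (mul_left_cancel₀ hh ?_)
  rw [mul_one]
  conv_rhs => rw [← hac, hd]
  ring

/-- Partial products `σ₁ ⋯ σ_m` of the generators act, up to conjugation by `x₁^h`, as a cyclic
permutation of the first `m + 1` basis elements. -/
theorem IsWada1.exists_cycle {n : ℕ} (hn : 0 < n) {h : ℤ}
    {ρ : BraidGroup (n - 1) →* MulAut (FreeGroup (Fin n))} (hρ : IsWada1 h ρ) (m : ℕ)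
    (hm : m < n) :
    ∃ β : BraidGroup (n - 1), ρ β (FreeGroup.of ⟨m, hm⟩) = FreeGroup.of ⟨0, hn⟩ ∧
      (∀ (k : ℕ) (hk : k < m), ρ β (FreeGroup.of ⟨k, by omega⟩) =
        FreeGroup.of ⟨0, hn⟩ ^ (-h) * FreeGroup.of ⟨k + 1, by omega⟩ *
          FreeGroup.of ⟨0, hn⟩ ^ h) ∧
      ∀ (k : ℕ) (hk : k < n), m < k → ρ β (FreeGroup.of ⟨k, hk⟩) = FreeGroup.of ⟨k, hk⟩ := by
  induction m with
  | zero => exact ⟨1, by simp, fun k hk => absurd hk (by omega), by simp⟩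
  | succ m ih =>
    obtain ⟨β, h1, h2, h3⟩ := ih (by omega)
    obtain ⟨s1, s2, s3⟩ := hρ ⟨m, by omega⟩
    simp only [idx0, idx1] at s1 s2 s3
    refine ⟨β * braidGen ⟨m, by omega⟩, ?_, fun k hk => ?_, fun k hk hmk => ?_⟩
    · rw [map_mul, MulAut.mul_apply, s2, h1]
    · rcases Nat.lt_succ_iff_lt_or_eq.1 hk with hk | rfl
      · rw [map_mul, MulAut.mul_apply, s3 _ (by simp; omega) (by simp; omega), h2 k hk]
      · rw [map_mul, MulAut.mul_apply, s1, map_mul, map_mul, map_zpow, map_zpow, h1,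
          h3 (k + 1) _ (by omega)]
    · rw [map_mul, MulAut.mul_apply, s3 _ (by simp; omega) (by simp; omega), h3 k hk (by omega)]

/-- A fixed element commutes with `xₙ^h ⋯ x₁^h`. -/
theorem IsWada1.commute_of_fixed {n : ℕ} (hn : 0 < n) {h : ℤ}
    {ρ : BraidGroup (n - 1) →* MulAut (FreeGroup (Fin n))} (hρ : IsWada1 h ρ)
    {u : FreeGroup (Fin n)} (hu : ∀ β, ρ β u = u) :
    Commute u (List.ofFn fun j : Fin n => (FreeGroup.of j) ^ h).reverse.prod := by
  obtain ⟨β, hlast, hlt, -⟩ := hρ.exists_cycle hn (n - 1) (by omega)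
  let X : ℕ → FreeGroup (Fin n) := fun i => FreeGroup.of ⟨i % n, Nat.mod_lt _ hn⟩
  have hX0 : X 0 = FreeGroup.of ⟨0, hn⟩ := by simp [X]
  have hXj : ∀ j : Fin n, X j = FreeGroup.of j := fun j => by simp [X, Nat.mod_eq_of_lt j.2]
  let τ : FreeGroup (Fin n) →* FreeGroup (Fin n) :=
    (MulAut.conj (X 0 ^ h) * ρ β).toMonoidHom
  have hτ : ∀ v, τ v = X 0 ^ h * ρ β v * (X 0 ^ h)⁻¹ := fun v => rfl
  have hτX : ∀ i, τ (X i) = X (i + 1) := by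
    intro i
    rw [hτ, hX0]
    have hi := Nat.mod_lt i hn
    rcases Nat.lt_or_ge (i % n) (n - 1) with hi' | hi'
    · have hmod : (i + 1) % n = i % n + 1 := by
        rw [← Nat.mod_add_mod, Nat.mod_eq_of_lt (by omega)]
      simp only [X, hlt _ hi', hmod]
      group
    · have hmod' : i % n = n - 1 := by omega
      have hmod : (i + 1) % n = 0 := by
        rw [← Nat.mod_add_mod, hmod', Nat.sub_add_cancel hn, Nat.mod_self]
      simp only [X, hmod', hlast, hmod]
      group
  have hiter : ∀ m i, τ^[m] (X i) = X (i + m) := by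
    intro m
    induction m with
    | zero => simp
    | succ m ih => intro i; rw [Function.iterate_succ_apply', ih, hτX, add_assoc]
  have hid : ∀ v, τ^[n] v = v := by
    intro v
    let τ' : Monoid.End (FreeGroup (Fin n)) := τ
    have hpow : τ' ^ n = 1 := by
      refine FreeGroup.ext_hom _ _ fun j => ?_
      change τ^[n] (FreeGroup.of j) = FreeGroup.of j
      rw [← hXj, hiter]
      simp [X]
    exact DFunLike.congr_fun hpow v
  have := iterate_shift_apply τ X h u hτX (by rw [hτ, hu]) n
  simp only [hXj, hid] at this
  exact eq_mul_inv_iff_mul_eq.1 this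

/-- The element `xₙ^h ⋯ x₁^h` is fixed by the braid group. -/
theorem IsWada1.apply_prod_zpow {n : ℕ} {h : ℤ}
    {ρ : BraidGroup (n - 1) →* MulAut (FreeGroup (Fin n))} (hρ : IsWada1 h ρ)
    (β : BraidGroup (n - 1)) :
    ρ β (List.ofFn fun j : Fin n => (FreeGroup.of j) ^ h).reverse.prod =
      (List.ofFn fun j : Fin n => (FreeGroup.of j) ^ h).reverse.prod := by
  set w := (List.ofFn fun j : Fin n => (FreeGroup.of j) ^ h).reverse.prod with hw
  suffices hβ : β ∈ (MulAction.stabilizer (MulAut (FreeGroup (Fin n))) w).comap ρ from hβ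
  have hle : Subgroup.closure (Set.range (PresentedGroup.of (rels := braidRels (n - 1)))) ≤
      (MulAction.stabilizer (MulAut (FreeGroup (Fin n))) w).comap ρ := by
    rw [Subgroup.closure_le]
    rintro _ ⟨k, rfl⟩
    change ρ (braidGen k) w = w
    obtain ⟨s1, s2, s3⟩ := hρ k
    rw [hw, map_list_prod, List.map_reverse, List.map_ofFn]
    have hk := k.2
    refine prod_reverse_ofFn_congr_adjacent n k (by omega) _ _ (fun j hj hj' => ?_) ?_
    · rw [Function.comp_apply, map_zpow,
        s3 j (fun e => hj (congrArg Fin.val e)) (fun e => hj' (congrArg Fin.val e))]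
    · change ρ (braidGen k) (FreeGroup.of (idx1 k) ^ h) *
        ρ (braidGen k) (FreeGroup.of (idx0 k) ^ h) =
          FreeGroup.of (idx1 k) ^ h * FreeGroup.of (idx0 k) ^ h
      have hconj := conj_zpow (i := h) (a := FreeGroup.of (idx0 k) ^ (-h))
        (b := FreeGroup.of (idx1 k))
      rw [zpow_neg, inv_inv] at hconj
      rw [map_zpow, map_zpow, s1, s2, zpow_neg, hconj]
      group
  exact hle (by rw [PresentedGroup.closure_range_of]; trivial)

theorem wada1_fixed_subgroup_braid (n : ℕ) (hn : 2 ≤ n) (h : ℤ) (hh : h ≠ 0)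
    (ρ : BraidGroup (n - 1) →* MulAut (FreeGroup (Fin n))) (hρ : IsWada1 h ρ) :
    {u : FreeGroup (Fin n) | ∀ β : BraidGroup (n - 1), ρ β u = u} =
      (Subgroup.zpowers
        ((List.ofFn (fun j : Fin n => (FreeGroup.of j) ^ h)).reverse.prod) :
        Subgroup (FreeGroup (Fin n))) := by
  ext u
  simp only [Set.mem_ofPred_eq, SetLike.mem_coe]
  constructor
  · intro hu
    obtain ⟨z, a, b, rfl, hb⟩ :=
      (hρ.commute_of_fixed (by omega) hu).exists_zpow_eq_of_freeGroup
    obtain ⟨n, rfl⟩ := Nat.exists_eq_add_of_le' hn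
    have hunit := isUnit_of_zpow_eq_prod_zpow n h hh z b hb
    rw [← hb]
    refine Subgroup.zpow_mem _ ?_ a
    rcases Int.isUnit_iff.1 hunit with rfl | rfl
    · exact ⟨1, by simp⟩
    · exact ⟨-1, by simp⟩
  · rintro ⟨m, rfl⟩ β
    change ρ β (_ ^ m) = _ ^ m
    rw [map_zpow, hρ.apply_prod_zpow]
end

section
/- Let n ≥ 2 and let k be a positive integer. Consider the action of Bₙ on Fₙ via the Wada representation ρ_k^{(1)}, and let Fₙ^{ρ_k^{(1)}(Bₙ)} = {u ∈ Fₙ : ρ_k^{(1)}(β)(u) = u for all β ∈ Bₙ}. Then the quotient of Fₙ by the normal closure of Fₙ^{ρ_k^{(1)}(Bₙ)} is isomorphic to the group ⟨ x₁, …, xₙ ∣ xₙ^{k} ⋯ x₂^{k} x₁^{k} = 1 ⟩, and its abelianization is isomorphic to (ℤ/kℤ) × ℤ^{n−1}. -/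
theorem FreeGroup.eq_of_commute_of {α : Type*} {a b : α}
    (h : Commute (FreeGroup.of a) (FreeGroup.of b)) : a = b := by
  classical
  by_contra hab
  have := h.map (FreeGroup.lift
    fun x => if x = a then Equiv.swap (0 : Fin 3) 1 else Equiv.swap (1 : Fin 3) 2)
  simp only [FreeGroup.lift_apply_of, if_true, if_neg (Ne.symm hab)] at this
  revert this
  unfold Commute SemiconjBy
  decide

theorem IsFreeGroup.isCyclic_of_comm {G : Type*} [Group G] [IsFreeGroup G]
    (h : ∀ x y : G, Commute x y) : IsCyclic G := by
  have hs : Subsingleton (IsFreeGroup.Generators G) := ⟨fun a b =>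
    FreeGroup.eq_of_commute_of (by
      simpa using (h (IsFreeGroup.mulEquiv G (.of a)) (IsFreeGroup.mulEquiv G (.of b))).map
        (IsFreeGroup.mulEquiv G).symm)⟩
  rcases isEmpty_or_nonempty (IsFreeGroup.Generators G) with he | ⟨⟨a⟩⟩
  · have := (IsFreeGroup.mulEquiv G).symm.toEquiv.subsingleton
    infer_instance
  · have := uniqueOfSubsingleton a
    exact ((IsFreeGroup.mulEquiv G).symm.trans FreeGroup.mulEquivIntOfUnique).isCyclic.mpr
      inferInstance

theorem FreeGroup.exists_zpow_of_commute {α : Type*} {u w : FreeGroup α} (h : Commute u w) :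
    ∃ g, u ∈ Subgroup.zpowers g ∧ w ∈ Subgroup.zpowers g := by
  let H := Subgroup.closure {u, w}
  have hc : IsMulCommutative H := Subgroup.isMulCommutative_closure (by
    rintro x (rfl | rfl) y (rfl | rfl) <;> first | rfl | exact h | exact h.symm)
  have : IsCyclic H := IsFreeGroup.isCyclic_of_comm fun x y => mul_comm' x y
  obtain ⟨g, hg⟩ := IsCyclic.exists_generator (α := H)
  have key : ∀ x ∈ H, x ∈ Subgroup.zpowers (g : FreeGroup α) := fun x hx => by
    obtain ⟨i, hi⟩ := hg ⟨x, hx⟩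
    exact ⟨i, by simpa using congrArg Subtype.val hi⟩
  exact ⟨g, key u (Subgroup.subset_closure (by simp)), key w (Subgroup.subset_closure (by simp))⟩

open Polynomial in
theorem Matrix.natDegree_trace_pow {R : Type*} [CommRing R] [IsDomain R]
    (M : Matrix (Fin 2) (Fin 2) R[X]) (hM : M.det = 1) (m : ℕ) :
    (M.trace.natDegree = 0 → (M ^ m).trace.natDegree = 0) ∧
      (M.trace.natDegree ≠ 0 → (M ^ m).trace.natDegree = m * M.trace.natDegree) := by
  have trace_rec (m : ℕ) : (M ^ (m + 2)).trace = M.trace * (M ^ (m + 1)).trace - (M ^ m).trace := by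
    rw [pow_add, pow_add, pow_one, pow_two]
    generalize M ^ m = N
    rw [Matrix.det_fin_two] at hM
    simp only [Matrix.trace_fin_two, Matrix.mul_apply, Fin.sum_univ_two]
    linear_combination -(N 0 0 + N 1 1) * hM
  induction m using Nat.twoStepInduction with
  | zero => simp
  | one => simp
  | more m h0 h1 =>
    rw [trace_rec]
    refine ⟨fun h => ?_, fun h => ?_⟩
    · have := (natDegree_sub_le (M.trace * (M ^ (m + 1)).trace) (M ^ m).trace).trans
        (max_le_max natDegree_mul_le le_rfl)
      rw [h, h1.1 h, h0.1 h] at this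
      simpa using this
    · have ht : M.trace ≠ 0 := by rintro h'; simp [h'] at h
      have ht' : (M ^ (m + 1)).trace ≠ 0 := by
        intro h'
        have := h1.2 h
        simp [h'] at this
        omega
      have hmul := natDegree_mul ht ht'
      rw [h1.2 h] at hmul
      rw [natDegree_sub_eq_left_of_natDegree_lt, hmul]
      · ring
      · rw [hmul, h0.2 h]
        have : 0 < M.trace.natDegree := Nat.pos_of_ne_zero h
        nlinarith

/-- The word `xₙᵏ ⋯ x₂ᵏ x₁ᵏ`. -/
def powWord (n k : ℕ) : FreeGroup (Fin n) :=
  (List.ofFn (fun j : Fin n => (FreeGroup.of j) ^ k)).reverse.prod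

open Polynomial in
theorem natAbs_eq_one_of_powWord_eq_zpow {n k : ℕ} (hn : 2 ≤ n) (hk : 0 < k)
    {g : FreeGroup (Fin n)} {a : ℤ} (h : g ^ a = powWord n k) : a.natAbs = 1 := by
  obtain ⟨m, rfl⟩ := Nat.exists_eq_add_of_le' hn
  let A : Matrix.SpecialLinearGroup (Fin 2) ℤ[X] := ⟨!![1, X; 0, 1], by simp⟩
  let B : Matrix.SpecialLinearGroup (Fin 2) ℤ[X] := ⟨!![1, 0; 1, 1], by simp⟩
  have hA (j : ℕ) : ((A ^ j : _) : Matrix (Fin 2) (Fin 2) ℤ[X]) = !![1, j * X; 0, 1] := by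
    induction j with
    | zero => simp [Matrix.one_fin_two]
    | succ j ih => rw [pow_succ, Matrix.SpecialLinearGroup.coe_mul, ih]; simp [A]; ring
  have hB (j : ℕ) : ((B ^ j : _) : Matrix (Fin 2) (Fin 2) ℤ[X]) = !![1, 0; (j : ℤ[X]), 1] := by
    induction j with
    | zero => simp [Matrix.one_fin_two]
    | succ j ih => rw [pow_succ, Matrix.SpecialLinearGroup.coe_mul, ih]; simp [B]
  let θ : FreeGroup (Fin (m + 2)) →* Matrix.SpecialLinearGroup (Fin 2) ℤ[X] :=
    FreeGroup.lift (Fin.cons A (Fin.cons B fun _ => 1))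
  have hθ : θ (powWord (m + 2) k) = B ^ k * A ^ k := by
    simp [powWord, θ, List.ofFn_succ, map_list_prod, List.map_reverse, List.map_ofFn,
      Function.comp_def, List.ofFn_const]
  obtain ⟨v, hv⟩ : ∃ v, v ^ a.natAbs = powWord (m + 2) k := by
    rcases a.natAbs_eq with ha | ha
    · exact ⟨g, by rw [← zpow_natCast, ← ha, h]⟩
    · exact ⟨g⁻¹, by rw [inv_pow, ← zpow_natCast, ← zpow_neg, ← ha, h]⟩
  have hd : ((θ v : Matrix (Fin 2) (Fin 2) ℤ[X]) ^ a.natAbs).trace.natDegree = 1 := by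
    rw [← Matrix.SpecialLinearGroup.coe_pow, ← map_pow, hv, hθ,
      Matrix.SpecialLinearGroup.coe_mul, hA, hB]
    have : (1 + ((k : ℤ[X]) * ((k : ℤ[X]) * (X : ℤ[X])) + 1)) = C ((k : ℤ) ^ 2) * X + C (2 : ℤ) := by
      simp; ring
    simp only [Matrix.trace_fin_two, Matrix.mul_apply, Fin.sum_univ_two]
    simp
    rw [this]
    exact natDegree_linear (by positivity)
  obtain ⟨h0, h1⟩ := Matrix.natDegree_trace_pow _ (θ v).det_coe a.natAbs
  by_cases hz : (θ v : Matrix (Fin 2) (Fin 2) ℤ[X]).trace.natDegree = 0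
  · rw [h0 hz] at hd; omega
  · rw [h1 hz] at hd
    exact Nat.eq_one_of_mul_eq_one_right hd

theorem mem_zpowers_powWord_of_commute {n k : ℕ} (hn : 2 ≤ n) (hk : 0 < k)
    {u : FreeGroup (Fin n)} (h : Commute u (powWord n k)) :
    u ∈ Subgroup.zpowers (powWord n k) := by
  obtain ⟨g, hu, ⟨a, ha⟩⟩ := FreeGroup.exists_zpow_of_commute h
  have := natAbs_eq_one_of_powWord_eq_zpow hn hk ha
  rcases Int.natAbs_eq a with h' | h' <;> rw [this] at h' <;> subst h' <;> simp at ha <;> rw [← ha]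
  · exact hu
  · simpa using hu

theorem IsWada1.exists_cycle_apply {m : ℕ} {h : ℤ}
    {ρ : BraidGroup (m + 1 - 1) →* MulAut (FreeGroup (Fin (m + 1)))} (hρ : IsWada1 h ρ)
    (j : ℕ) (hj : j ≤ m) :
    ∃ β, (∀ i : Fin (m + 1), i.1 < j →
        ρ β (.of i) = .of 0 ^ (-h) * .of (i + 1) * .of 0 ^ h) ∧
      ∀ i : Fin (m + 1), (i.1 = j → ρ β (.of i) = .of 0) ∧ (j < i.1 → ρ β (.of i) = .of i) := by
  induction j with
  | zero =>
    refine ⟨1, by simp, fun i => ⟨fun hi => ?_, by simp⟩⟩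
    obtain rfl : i = 0 := Fin.ext hi
    simp
  | succ j ih =>
    obtain ⟨β, hlt, hge⟩ := ih (by omega)
    let s : Fin (m + 1 - 1) := ⟨j, by omega⟩
    obtain ⟨h0, h1, h2⟩ := hρ s
    have hsucc : idx0 s + 1 = idx1 s := by
      ext
      rw [Fin.val_add_one_of_lt]
      · rfl
      · simp [Fin.lt_def, idx0, s]; omega
    refine ⟨β * braidGen s, fun i hi => ?_, fun i => ⟨fun hi => ?_, fun hi => ?_⟩⟩ <;>
      rw [map_mul, MulAut.mul_apply]
    · rcases Nat.lt_succ_iff_lt_or_eq.mp hi with hi | hi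
      · rw [h2 i (by simp [Fin.ext_iff, idx0, s]; omega) (by simp [Fin.ext_iff, idx1, s]; omega),
          hlt i hi]
      · obtain rfl : i = idx0 s := Fin.ext hi
        rw [h0, hsucc, map_mul, map_mul, map_zpow, map_zpow, (hge _).1 rfl,
          (hge (idx1 s)).2 (by simp [idx1, s])]
    · obtain rfl : i = idx1 s := Fin.ext hi
      rw [h1, (hge _).1 rfl]
    · rw [h2 i (by simp [Fin.ext_iff, idx0, s]; omega) (by simp [Fin.ext_iff, idx1, s]; omega),
        (hge i).2 (by omega)]

theorem Fin.ofNat_add_one (m j : ℕ) : Fin.ofNat (m + 1) (j + 1) = Fin.ofNat (m + 1) j + 1 := by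
  ext
  simp [Fin.val_add]

/-- The suffix `xᵢᵏ ⋯ x₁ᵏ` of `powWord (m + 1) k`. -/
def powWordSuffix (m k i : ℕ) : FreeGroup (Fin (m + 1)) :=
  ((List.range i).map fun j => .of (Fin.ofNat (m + 1) j) ^ k).reverse.prod

theorem powWordSuffix_succ (m k i : ℕ) :
    powWordSuffix m k (i + 1) = .of (Fin.ofNat (m + 1) i) ^ k * powWordSuffix m k i := by
  simp [powWordSuffix, List.range_succ]

theorem powWordSuffix_succ' (m k i : ℕ) : powWordSuffix m k (i + 1) =
    FreeGroup.map (· + (1 : Fin (m + 1))) (powWordSuffix m k i) * .of 0 ^ k := by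
  simp [powWordSuffix, List.range_succ_eq_map, map_list_prod, List.map_reverse,
    Function.comp_def, Fin.ofNat_add_one, -Fin.ofNat_eq_cast]

theorem powWordSuffix_self (m k : ℕ) : powWordSuffix m k (m + 1) = powWord (m + 1) k := by
  rw [powWordSuffix, powWord]
  congr 2
  refine List.ext_getElem (by simp) fun i h1 h2 => ?_
  have hi : i < m + 1 := by simpa using h1
  have : Fin.ofNat (m + 1) i = ⟨i, hi⟩ := Fin.ext (Nat.mod_eq_of_lt hi)
  simp [this, -Fin.ofNat_eq_cast, -List.ofFn_succ]

theorem IsWada1.commute_powWord {m k : ℕ}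
    {ρ : BraidGroup (m + 1 - 1) →* MulAut (FreeGroup (Fin (m + 1)))} (hρ : IsWada1 (k : ℤ) ρ)
    {u : FreeGroup (Fin (m + 1))} (hu : ∀ β, ρ β u = u) : Commute u (powWord (m + 1) k) := by
  obtain ⟨β, hlt, hge⟩ := hρ.exists_cycle_apply m le_rfl
  let x : FreeGroup (Fin (m + 1)) := .of 0 ^ k
  have hβ : (MulAut.conj x).toMonoidHom.comp (ρ β).toMonoidHom =
      FreeGroup.map (· + (1 : Fin (m + 1))) := by
    ext i
    rcases Nat.lt_succ_iff_lt_or_eq.mp i.2 with hi | hi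
    · simp [hlt i hi, x, mul_assoc, -map_pow]
    · obtain rfl : i = Fin.last m := Fin.ext hi
      simp [(hge (Fin.last m)).1 rfl, x, -map_pow, ← pow_succ, pow_succ']
  have h1 : FreeGroup.map (· + (1 : Fin (m + 1))) u = x * u * x⁻¹ := by
    simp [← hβ, hu β]
  have key (i : ℕ) : FreeGroup.map (· + Fin.ofNat (m + 1) i) u =
      powWordSuffix m k i * u * (powWordSuffix m k i)⁻¹ := by
    induction i with
    | zero => simp [powWordSuffix]
    | succ i ih =>
      have := congrArg (FreeGroup.map (· + (1 : Fin (m + 1)))) ih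
      rw [FreeGroup.map.comp, map_mul, map_mul, h1, map_inv] at this
      simpa [powWordSuffix_succ', mul_assoc, Function.comp_def, add_assoc, Fin.ofNat_add_one, x,
        -Fin.ofNat_eq_cast] using this
  have hn : Fin.ofNat (m + 1) (m + 1) = 0 := Fin.ext (Nat.mod_self _)
  have := key (m + 1)
  rw [powWordSuffix_self, hn] at this
  simp only [add_zero, FreeGroup.map.id'] at this
  exact eq_mul_inv_iff_mul_eq.mp this

theorem IsWada1.apply_powWord {m k : ℕ}
    {ρ : BraidGroup (m + 1 - 1) →* MulAut (FreeGroup (Fin (m + 1)))} (hρ : IsWada1 (k : ℤ) ρ)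
    (β : BraidGroup (m + 1 - 1)) : ρ β (powWord (m + 1) k) = powWord (m + 1) k := by
  suffices hgen : ∀ s, ρ (braidGen s) (powWord (m + 1) k) = powWord (m + 1) k by
    have : (⊤ : Subgroup (BraidGroup (m + 1 - 1))) ≤
        (MulAction.stabilizer (MulAut (FreeGroup (Fin (m + 1)))) (powWord (m + 1) k)).comap ρ := by
      rw [← PresentedGroup.closure_range_of, Subgroup.closure_le]
      rintro _ ⟨s, rfl⟩
      exact hgen s
    exact this (Subgroup.mem_top β)
  intro s
  obtain ⟨h0, h1, h2⟩ := hρ s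
  have hs : s.1 < m := s.2
  have hfix (i : ℕ) (hi : i < m + 1) (hi0 : i ≠ s.1) (hi1 : i ≠ s.1 + 1) :
      ρ (braidGen s) (.of (Fin.ofNat (m + 1) i)) = .of (Fin.ofNat (m + 1) i) :=
    h2 _ (by simpa [Fin.ext_iff, idx0, Nat.mod_eq_of_lt hi] using hi0)
      (by simpa [Fin.ext_iff, idx1, Nat.mod_eq_of_lt hi] using hi1)
  have hlow (i : ℕ) (hi : i ≤ s.1) :
      ρ (braidGen s) (powWordSuffix m k i) = powWordSuffix m k i := by
    induction i with
    | zero => simp [powWordSuffix]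
    | succ i ih =>
      rw [powWordSuffix_succ, map_mul, map_pow, ih (by omega),
        hfix i (by omega) (by omega) (by omega)]
  have hhigh (i : ℕ) (hi : s.1 + 2 ≤ i) (him : i ≤ m + 1) :
      ρ (braidGen s) (powWordSuffix m k i) = powWordSuffix m k i := by
    induction i, hi using Nat.le_induction with
    | base =>
      have e0 : Fin.ofNat (m + 1) s.1 = idx0 s := Fin.ext (Nat.mod_eq_of_lt (by omega))
      have e1 : Fin.ofNat (m + 1) (s.1 + 1) = idx1 s := Fin.ext (Nat.mod_eq_of_lt (by omega))
      have hconj := conj_pow (i := k) (a := FreeGroup.of (idx0 s) ^ (-(k : ℤ)))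
        (b := FreeGroup.of (idx1 s))
      rw [zpow_neg, inv_inv] at hconj
      rw [powWordSuffix_succ, powWordSuffix_succ, e0, e1, map_mul, map_mul, map_pow, map_pow,
        hlow _ le_rfl, h0, h1, zpow_neg, hconj, zpow_natCast]
      simp [mul_assoc]
    | succ i hi ih =>
      rw [powWordSuffix_succ, map_mul, map_pow, ih (by omega),
        hfix i (by omega) (by omega) (by omega)]
  rw [← powWordSuffix_self]
  exact hhigh _ (by omega) le_rfl

theorem IsWada1.normalClosure_fixed {m k : ℕ} (hm : 0 < m) (hk : 0 < k)
    {ρ : BraidGroup (m + 1 - 1) →* MulAut (FreeGroup (Fin (m + 1)))} (hρ : IsWada1 (k : ℤ) ρ) :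
    Subgroup.normalClosure {u | ∀ β, ρ β u = u} = Subgroup.normalClosure {powWord (m + 1) k} := by
  apply le_antisymm
  · refine Subgroup.normalClosure_le_normal fun u hu => ?_
    refine (Subgroup.zpowers_le.mpr ?_)
      (mem_zpowers_powWord_of_commute (by omega) hk (hρ.commute_powWord hu))
    exact Subgroup.subset_normalClosure rfl
  · exact Subgroup.normalClosure_mono (by simpa using hρ.apply_powWord)

theorem map_powWord_of_comm {A : Type*} [CommGroup A] {n : ℕ} (k : ℕ)
    (f : FreeGroup (Fin n) →* A) : f (powWord n k) = (∏ i, f (.of i)) ^ k := by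
  simp [powWord, map_list_prod, List.map_ofFn, List.prod_reverse, List.prod_ofFn,
    Finset.prod_pow]

theorem nonempty_abelianization_powWord (m k : ℕ) :
    Nonempty (Additive (Abelianization (PresentedGroup {powWord (m + 1) k})) ≃+
      (ZMod k × (Fin m → ℤ))) := by
  let G := PresentedGroup {powWord (m + 1) k}
  let x (i : Fin (m + 1)) : Additive (Abelianization G) :=
    .ofMul (Abelianization.of (PresentedGroup.of i))
  let y : Fin (m + 1) → ZMod k × (Fin m → ℤ) :=
    Fin.cons (1, fun _ => -1) fun i => (0, Pi.single i 1)
  have hy : ∑ i, y i = (1, 0) := by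
    ext j <;> simp [y, Fin.sum_univ_succ, Prod.fst_sum, Prod.snd_sum, Finset.sum_apply,
      Pi.single_apply]
  have hrel : ∀ r ∈ ({powWord (m + 1) k} : Set (FreeGroup (Fin (m + 1)))),
      FreeGroup.lift (fun i => Multiplicative.ofAdd (y i)) r = 1 := by
    rintro _ rfl
    rw [map_powWord_of_comm]
    simp only [FreeGroup.lift_apply_of]
    rw [← ofAdd_sum, hy, ← ofAdd_nsmul]
    simp
  let f : Additive (Abelianization G) →+ ZMod k × (Fin m → ℤ) :=
    MonoidHom.toAdditiveLeft (Abelianization.lift (PresentedGroup.toGroup hrel))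
  have hx : k • ∑ i, x i = 0 := by
    have := map_powWord_of_comm k
      ((Abelianization.of (G := G)).comp (PresentedGroup.mk {powWord (m + 1) k}))
    rw [MonoidHom.comp_apply, PresentedGroup.one_of_mem (rels := {powWord (m + 1) k}) rfl, map_one] at this
    exact congrArg Additive.ofMul this.symm
  let g₁ : ZMod k →+ Additive (Abelianization G) :=
    ZMod.lift k ⟨zmultiplesHom _ (∑ i, x i), by simpa using hx⟩
  have hg₁ : g₁ 1 = ∑ i, x i := by
    have := ZMod.lift_coe k (⟨zmultiplesHom _ (∑ i, x i), by simpa using hx⟩ :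
      { f : ℤ →+ Additive (Abelianization G) // f k = 0 }) 1
    simpa using this
  let g₂ : (Fin m → ℤ) →+ Additive (Abelianization G) :=
    (Fintype.linearCombination ℤ fun i : Fin m => x i.succ).toAddMonoidHom
  have hg₂ (c : Fin m → ℤ) : g₂ c = ∑ i, c i • x i.succ := rfl
  have hf (i : Fin (m + 1)) : f (x i) = y i := by
    exact congrArg Multiplicative.toAdd (PresentedGroup.toGroup.of hrel)
  refine ⟨AddMonoidHom.toAddEquiv f (g₁.coprod g₂) ?_ ?_⟩
  · apply AddMonoidHom.toMultiplicative.injective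
    ext i
    change g₁.coprod g₂ (f (x i)) = x i
    rw [hf]
    cases i using Fin.cases with
    | zero => simp [y, hg₁, hg₂, Fin.sum_univ_succ]
    | succ i => simp [y, hg₂, Pi.single_apply]
  · apply AddMonoidHom.ext
    rintro ⟨a, c⟩
    obtain ⟨a, rfl⟩ := ZMod.intCast_surjective a
    have h1 : g₁ (a : ZMod k) = a • ∑ i, x i := by rw [← hg₁, ← map_zsmul]; simp
    simp only [AddMonoidHom.comp_apply, AddMonoidHom.coprod_apply, h1, hg₂, map_add, map_zsmul,
      map_sum, hf, hy]
    ext j <;> simp [y, Prod.fst_sum, Prod.snd_sum, Pi.single_apply]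

theorem wada1_quotient_by_fixed (n : ℕ) (hn : 2 ≤ n) (k : ℕ) (hk : 0 < k)
    (ρ : BraidGroup (n - 1) →* MulAut (FreeGroup (Fin n))) (hρ : IsWada1 (k : ℤ) ρ) :
    Nonempty ((FreeGroup (Fin n) ⧸
        Subgroup.normalClosure {u : FreeGroup (Fin n) | ∀ β : BraidGroup (n - 1), ρ β u = u}) ≃*
      PresentedGroup
        ({(List.ofFn (fun j : Fin n => (FreeGroup.of j) ^ k)).reverse.prod} :
          Set (FreeGroup (Fin n)))) ∧
    Nonempty (Additive (Abelianization (FreeGroup (Fin n) ⧸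
        Subgroup.normalClosure {u : FreeGroup (Fin n) | ∀ β : BraidGroup (n - 1), ρ β u = u})) ≃+
      (ZMod k × (Fin (n - 1) → ℤ))) := by
  obtain ⟨m, rfl⟩ := Nat.exists_eq_add_of_le' (show 1 ≤ n by omega)
  have e := QuotientGroup.quotientMulEquivOfEq (hρ.normalClosure_fixed (by omega) hk)
  obtain ⟨e'⟩ := nonempty_abelianization_powWord m k
  exact ⟨⟨e⟩, ⟨e.abelianizationCongr.toAdditive.trans e'⟩⟩
end
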